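/- Let A be an Artin algebra, D ⊆ mod A a 0-Igusa-Todorov subcategory, and I an ideal of A with rad(A)·I = 0. If the subcategory mod(A/I) ⊆ mod A is 0-LIT (with LIT module V and 0-Igusa-Todorov subcategory D), then A is a 1-LIT algebra with the same LIT module V. -/

import Mathlib

/-!
Common framework for formalizing "On Lat-Igusa-Todorov algebras" (Barrios–Mata).

For a ring `S`, `FGMod S` is the "category" of finitely generated (left) `S`-modules;
for an Artin algebra `A`, the category `mod A` of finitely generated *right*
`A`-modules is `FGMod Aᵐᵒᵖ`.
-/

universe u v

open Function

namespace LIT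

/-- The `η` invariant from Fitting's Lemma: for an endomorphism `L` of an abelian
group `G` and a subgroup `X`, the least `k` such that for all `m ≥ k` the
restriction of `L` to `L^m(X)` is a monomorphism `L^m(X) → L^{m+1}(X)`. -/
noncomputable def eta {G : Type v} [AddCommGroup G] (L : AddMonoid.End G)
    (X : AddSubgroup G) : ℕ :=
  sInf {k : ℕ | ∀ m : ℕ, k ≤ m → Set.InjOn L (X.map (L ^ m) : Set G)}

/-- Bundled finitely generated `S`-modules. -/
structure FGMod (S : Type u) [Ring S] : Type (u + 1) where
  carrier : Type u
  [isAddCommGroup : AddCommGroup carrier]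
  [isModule : Module S carrier]
  [isFinite : Module.Finite S carrier]

attribute [instance] FGMod.isAddCommGroup FGMod.isModule FGMod.isFinite

/-- The regular module `S` over itself. -/
def FGMod.regular (S : Type u) [Ring S] : FGMod S := ⟨S⟩

/-- A ring is finitely generated as a right module over itself. -/
instance (A : Type u) [Ring A] : Module.Finite Aᵐᵒᵖ A :=
  Module.Finite.of_surjective
    ({ toFun := MulOpposite.unop
       map_add' := fun _ _ => rfl
       map_smul' := fun _ _ => rfl } : Aᵐᵒᵖ →ₗ[Aᵐᵒᵖ] A)
    (fun x => ⟨MulOpposite.op x, rfl⟩)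

namespace FGMod

variable {S : Type u} [Ring S]

/-- Projectivity of a module. -/
def IsProj (M : FGMod S) : Prop := Module.Projective S M.carrier

/-- Direct sum (product) of two modules. -/
def prodMod (M N : FGMod S) : FGMod S := ⟨M.carrier × N.carrier⟩

/-- Finite direct sums. -/
def dsum {n : ℕ} (f : Fin n → FGMod S) : FGMod S := ⟨∀ i, (f i).carrier⟩

/-- `N` is a direct summand of `M`. -/
def IsSummand (N M : FGMod S) : Prop :=
  ∃ N' : FGMod S, Nonempty (M.carrier ≃ₗ[S] N.carrier × N'.carrier)

/-- `addOf C` is `add C`: all direct summands of finite direct sums of modules of `C`. -/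
def addOf (C : Set (FGMod S)) : Set (FGMod S) :=
  {N | ∃ (n : ℕ) (f : Fin n → FGMod S), (∀ i, f i ∈ C) ∧ IsSummand N (dsum f)}

/-- `f : P → M` is a projective cover: `P` projective, `f` surjective with superfluous kernel. -/
def IsProjCover {P M : FGMod S} (f : P.carrier →ₗ[S] M.carrier) : Prop :=
  P.IsProj ∧ Surjective f ∧
    ∀ N : Submodule S P.carrier, N ⊔ LinearMap.ker f = ⊤ → N = ⊤

/-- `N` is (isomorphic to) the syzygy `Ω(M)`, i.e. the kernel of a projective cover of `M`. -/
def IsSyzygyOf (N M : FGMod S) : Prop :=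
  ∃ (P : FGMod S) (f : P.carrier →ₗ[S] M.carrier),
    IsProjCover f ∧ Nonempty (N.carrier ≃ₗ[S] LinearMap.ker f)

/-- The syzygy `Ω(M)` of `M` (a choice of it; over an Artin algebra it exists and is
unique up to isomorphism). -/
noncomputable def syz (M : FGMod S) : FGMod S :=
  letI := Classical.propDecidable (∃ N, IsSyzygyOf N M)
  if h : ∃ N, IsSyzygyOf N M then h.choose else M

/-- `SES X Y Z` : there is a short exact sequence `0 → X → Y → Z → 0`. -/
def SES (X Y Z : FGMod S) : Prop :=
  ∃ (f : X.carrier →ₗ[S] Y.carrier) (g : Y.carrier →ₗ[S] Z.carrier),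
    Injective f ∧ Surjective g ∧ LinearMap.range f = LinearMap.ker g

/-- Projective dimension, via vanishing of syzygies. -/
noncomputable def pdim (M : FGMod S) : ℕ∞ :=
  sInf ((↑) '' {n : ℕ | (syz^[n] M).IsProj})

end FGMod

open FGMod

variable {S : Type u} [Ring S]

/-- The finitistic dimension of a class of modules: the supremum of the projective
dimensions of its modules of finite projective dimension. -/
noncomputable def findim (C : Set (FGMod S)) : ℕ∞ :=
  ⨆ M ∈ {M ∈ C | pdim M ≠ ⊤}, pdim M

/-- The global dimension of a class of modules. -/
noncomputable def gldim (C : Set (FGMod S)) : ℕ∞ :=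
  ⨆ M ∈ C, pdim M

/-- The defining relations of `K₀`: `[M] - [M'] - [M'']` for `M ≅ M' ⊕ M''`, and `[P]`
for `P` projective. -/
def K0Rels (S : Type u) [Ring S] : AddSubgroup (FreeAbelianGroup (FGMod S)) :=
  AddSubgroup.closure
    ({x | ∃ M M' M'' : FGMod S,
        Nonempty (M.carrier ≃ₗ[S] M'.carrier × M''.carrier) ∧
        x = FreeAbelianGroup.of M - FreeAbelianGroup.of M' - FreeAbelianGroup.of M''} ∪
      {x | ∃ P : FGMod S, P.IsProj ∧ x = FreeAbelianGroup.of P})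

/-- `K₀(A)`: the free abelian group on the modules modulo the relations above. -/
abbrev K0 (S : Type u) [Ring S] : Type (u + 1) :=
  FreeAbelianGroup (FGMod S) ⧸ K0Rels S

/-- The class `[M]` of a module in `K₀`. -/
def toK0 (M : FGMod S) : K0 S := QuotientAddGroup.mk (FreeAbelianGroup.of M)

/-- `⟨C⟩`: the subgroup of `K₀` generated by the classes of direct summands of
modules of `C`. -/
def grpOf (C : Set (FGMod S)) : AddSubgroup (K0 S) :=
  AddSubgroup.closure {x | ∃ N M : FGMod S, M ∈ C ∧ IsSummand N M ∧ x = toK0 N}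

/-- `K_D = K₀/⟨D⟩`. -/
abbrev KD (D : Set (FGMod S)) : Type (u + 1) := K0 S ⧸ grpOf D

/-- The class of a module in `K_D`. -/
def toKD (D : Set (FGMod S)) (M : FGMod S) : KD D :=
  QuotientAddGroup.mk (toK0 M)

/-- `L` is the endomorphism `Ω̄` of `K₀` induced by the syzygy operator (it is unique). -/
def IsSyzEnd (L : AddMonoid.End (K0 S)) : Prop :=
  ∀ M : FGMod S, L (toK0 M) = toK0 (syz M)

/-- `L` is the endomorphism `Ω̄_D` of `K_D` induced by the syzygy operator. -/
def IsSyzEndD (D : Set (FGMod S)) (L : AddMonoid.End (KD D)) : Prop :=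
  ∀ M : FGMod S, L (toKD D M) = toKD D (syz M)

/-- The Igusa–Todorov function `φ`, relative to the induced endomorphism `L = Ω̄` of `K₀`. -/
noncomputable def phi (L : AddMonoid.End (K0 S)) (M : FGMod S) : ℕ :=
  eta L (grpOf {M})

/-- `φ`-dimension of a class of modules. -/
noncomputable def phidim (L : AddMonoid.End (K0 S)) (C : Set (FGMod S)) : ℕ∞ :=
  ⨆ M ∈ C, (phi L M : ℕ∞)

/-- The generalized Igusa–Todorov function `φ_[D]`, relative to `L = Ω̄_D`. -/
noncomputable def phiD (D : Set (FGMod S)) (L : AddMonoid.End (KD D)) (M : FGMod S) : ℕ :=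
  eta L ((grpOf {M}).map (QuotientAddGroup.mk' (grpOf D)))

/-- The generalized Igusa–Todorov function `ψ_[D]`. -/
noncomputable def psiD (D : Set (FGMod S)) (L : AddMonoid.End (KD D)) (M : FGMod S) : ℕ∞ :=
  (phiD D L M : ℕ∞) + findim (addOf {syz^[phiD D L M] M})

/-- `D` is a `0`-Igusa–Todorov subcategory: `D = add D`, `Ω(D) ⊆ D` and `φdim D = 0`. -/
def IsZeroIT (L : AddMonoid.End (K0 S)) (D : Set (FGMod S)) : Prop :=
  D = addOf D ∧ (∀ M ∈ D, syz M ∈ D) ∧ phidim L D = 0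

/-- The class `C` is `(n,V,D)`-Lat-Igusa-Todorov: every `M ∈ C` admits an exact sequence
`0 → V₁ ⊕ D₁ → V₀ ⊕ D₀ → Ωⁿ(M) → 0` with `V₁, V₀ ∈ add V` and `D₁, D₀ ∈ D`. -/
def IsLITClass (n : ℕ) (V : FGMod S) (D : Set (FGMod S)) (C : Set (FGMod S)) : Prop :=
  ∀ M ∈ C, ∃ V1 V0 D1 D0 : FGMod S,
    V1 ∈ addOf {V} ∧ V0 ∈ addOf {V} ∧ D1 ∈ D ∧ D0 ∈ D ∧
    SES (prodMod V1 D1) (prodMod V0 D0) (syz^[n] M)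

/-- `[C]_D`: the image of `⟨C⟩` in `K_D`, i.e. `(⟨C⟩ + ⟨D⟩)/⟨D⟩`. -/
def classGrpD (D C : Set (FGMod S)) : AddSubgroup (KD D) :=
  (grpOf C).map (QuotientAddGroup.mk' (grpOf D))

/-- `C` is `D`-syzygy finite: `[Ω^k(C)]_D` is finitely generated for some `k`. -/
def DSyzFinite (D C : Set (FGMod S)) : Prop :=
  ∃ k : ℕ, (classGrpD D ((fun M => syz^[k] M) '' C)).FG

/-- The algebra is `n`-LIT: there are a `0`-Igusa–Todorov subcategory `D` and a module `V`
such that `mod A` is `(n,V,D)`-LIT. -/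
def IsNLITAlgebra (L : AddMonoid.End (K0 S)) (n : ℕ) : Prop :=
  ∃ (V : FGMod S) (D : Set (FGMod S)), IsZeroIT L D ∧ IsLITClass n V D Set.univ

/-- The algebra is LIT: it is `n`-LIT for some `n`. -/
def IsLITAlgebra (L : AddMonoid.End (K0 S)) : Prop :=
  ∃ n : ℕ, IsNLITAlgebra L n


/-! Indecomposable modules, finiteness up to isomorphism, and modules over quotient
algebras viewed inside `mod A`. -/

/-- `M` is indecomposable: nonzero, and any direct sum decomposition is trivial. -/
def Indec {S : Type u} [Ring S] (M : FGMod S) : Prop :=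
  ¬ Subsingleton M.carrier ∧
    ∀ N N' : FGMod S, Nonempty (M.carrier ≃ₗ[S] N.carrier × N'.carrier) →
      Subsingleton N.carrier ∨ Subsingleton N'.carrier

/-- A class of modules contains only finitely many isomorphism classes. -/
def FinUpToIso {S : Type u} [Ring S] (C : Set (FGMod S)) : Prop :=
  ∃ (n : ℕ) (f : Fin n → FGMod S),
    ∀ M ∈ C, ∃ i, Nonempty (M.carrier ≃ₗ[S] (f i).carrier)

/-- The right `A`-modules annihilated by a (two-sided) ideal `I`, i.e. the image of
`mod (A/I)` inside `mod A`. -/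
def annClass {A : Type u} [Ring A] (I : Submodule Aᵐᵒᵖ A) : Set (FGMod Aᵐᵒᵖ) :=
  {M | ∀ (m : M.carrier), ∀ a ∈ I, MulOpposite.op a • m = 0}

/-- The right `A`-module `A/I`. -/
def qmod {A : Type u} [Ring A] (I : Submodule Aᵐᵒᵖ A) : FGMod Aᵐᵒᵖ := ⟨A ⧸ I⟩

/-- Every submodule of an Artinian module has a supplement. -/
theorem exists_supplement {S M : Type*} [Ring S] [AddCommGroup M] [Module S M]
    [IsArtinian S M] (K : Submodule S M) :
    ∃ N : Submodule S M, N ⊔ K = ⊤ ∧ ∀ N' ≤ N, N' ⊔ K = ⊤ → N' = N := by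
  obtain ⟨N, hN, hmin⟩ := IsArtinian.set_has_minimal {N : Submodule S M | N ⊔ K = ⊤}
    ⟨⊤, top_sup_eq K⟩
  exact ⟨N, hN, fun N' hle hN' ↦ by_contra fun hne ↦ hmin N' hN' (lt_of_le_of_ne hle hne)⟩

/-- Finitely generated modules over an Artinian ring have projective covers. -/
theorem exists_isProjCover {S : Type u} [Ring S] [IsArtinianRing S] (M : FGMod S) :
    ∃ (P : FGMod S) (f : P.carrier →ₗ[S] M.carrier), IsProjCover f := by
  obtain ⟨n, g, hg⟩ := Module.Finite.exists_fin' S M.carrier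
  obtain ⟨N, hN, hmin⟩ := exists_supplement (LinearMap.ker g)
  let f : N →ₗ[S] M.carrier := g.domRestrict N
  have hf : Surjective f := by
    intro m
    obtain ⟨x, rfl⟩ := hg m
    obtain ⟨y, hy, z, hz, rfl⟩ := Submodule.mem_sup.mp (hN ▸ Submodule.mem_top : x ∈ N ⊔ _)
    exact ⟨⟨y, hy⟩, by simp [f, LinearMap.mem_ker.mp hz]⟩
  have superfluous : ∀ N' : Submodule S N, N' ⊔ LinearMap.ker f = ⊤ → N' = ⊤ := by
    intro N' hN'
    have hle : N ≤ N'.map N.subtype ⊔ LinearMap.ker g := by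
      intro x hx
      obtain ⟨y, hy, z, hz, hyz⟩ :=
        Submodule.mem_sup.mp (hN' ▸ Submodule.mem_top : (⟨x, hx⟩ : N) ∈ N' ⊔ _)
      exact Submodule.mem_sup.mpr ⟨y, ⟨y, hy, rfl⟩, z, hz, congrArg Subtype.val hyz⟩
    have h := hmin (N'.map N.subtype) (Submodule.map_subtype_le N N')
      (top_le_iff.mp (hN ▸ sup_le hle le_sup_right))
    apply Submodule.map_injective_of_injective N.injective_subtype
    rw [h, Submodule.map_subtype_top]
  obtain ⟨p, hp⟩ := Module.projective_lifting_property f g hf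
  let q : N →ₗ[S] N := p.domRestrict N
  have hfq : ∀ x, f (q x) = f x := fun x ↦ LinearMap.congr_fun hp x
  have hq : Surjective q := by
    refine LinearMap.range_eq_top.mp (superfluous _ (top_le_iff.mp fun x _ ↦ ?_))
    refine Submodule.mem_sup.mpr ⟨q x, ⟨x, rfl⟩, x - q x, ?_, add_sub_cancel _ _⟩
    rw [LinearMap.mem_ker, map_sub, hfq, sub_self]
  let e : N ≃ₗ[S] N := .ofBijective q ⟨IsNoetherian.injective_of_surjective_endomorphism q hq, hq⟩
  have hproj : Module.Projective S N :=
    .of_split (N.subtype.comp e.symm.toLinearMap) p (LinearMap.ext fun x ↦ e.apply_symm_apply x)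
  exact ⟨⟨N⟩, f, hproj, hf, superfluous⟩

theorem isSyzygyOf_syz {S : Type u} [Ring S] [IsArtinianRing S] (M : FGMod S) :
    IsSyzygyOf (syz M) M := by
  obtain ⟨P, f, hf⟩ := exists_isProjCover M
  have h : ∃ N, IsSyzygyOf N M := ⟨⟨LinearMap.ker f⟩, P, f, hf, ⟨.refl S _⟩⟩
  rw [syz, dif_pos h]
  exact h.choose_spec

/-- A superfluous submodule is contained in the radical. -/
theorem le_jacobson_of_superfluous {S M : Type*} [Ring S] [AddCommGroup M] [Module S M]
    {K : Submodule S M} (hK : ∀ N : Submodule S M, N ⊔ K = ⊤ → N = ⊤) :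
    K ≤ Module.jacobson S M :=
  le_sInf fun N (hN : IsCoatom N) ↦ by
    by_contra h
    exact hN.1 (hK N (hN.2 _ (left_lt_sup.mpr h)))

/-- An element annihilating the radical of the ring annihilates the radical of every
projective module. -/
theorem smul_eq_zero_of_mem_jacobson {S P : Type*} [Ring S] [AddCommGroup P] [Module S P]
    [Module.Projective S P] {a : S} (ha : ∀ j ∈ Ring.jacobson S, a * j = 0) {x : P}
    (hx : x ∈ Module.jacobson S P) : a • x = 0 := by
  obtain ⟨s, hs⟩ := Module.projective_def'.mp (inferInstance : Module.Projective S P)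
  have h : a • s x = 0 := by
    ext p
    exact ha _ (Module.le_comap_jacobson ((Finsupp.lapply p).comp s) hx)
  have hsx := LinearMap.congr_fun hs x
  rw [LinearMap.comp_apply, LinearMap.id_apply] at hsx
  rw [← hsx, ← map_smul, h, map_zero]

/-- The radical of the opposite of a Dedekind-finite ring lies in the radical of the ring. -/
theorem unop_mem_jacobson {A : Type*} [Ring A] [IsDedekindFiniteMonoid A] {x : Aᵐᵒᵖ}
    (hx : x ∈ Ring.jacobson Aᵐᵒᵖ) : x.unop ∈ Ideal.jacobson (⊥ : Ideal A) := by
  rw [Ideal.mem_jacobson_iff]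
  intro y
  have hxy : x * MulOpposite.op y ∈ Ideal.jacobson (⊥ : Ideal Aᵐᵒᵖ) := by
    rw [Ideal.jacobson_bot]
    exact Ideal.mul_mem_right _ _ hx
  obtain ⟨s, hs⟩ := Ideal.exists_mul_add_sub_mem_of_mem_jacobson _ hxy
  have h : (y * x.unop + 1) * s.unop = 1 :=
    congrArg MulOpposite.unop (sub_eq_zero.mp (Ideal.mem_bot.mp hs))
  refine ⟨s.unop, Ideal.mem_bot.mpr (sub_eq_zero.mpr ?_)⟩
  rw [← mul_eq_one_symm h, mul_add, mul_one, mul_assoc]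

/-!
STATEMENT 14 (Proposition).  Let `D` be a `0`-Igusa-Todorov subcategory and `I` an
ideal of `A` with `rad(A)·I = 0`.  If the subcategory `mod (A/I) ⊆ mod A` is `0`-LIT
with LIT module `V` and `0`-Igusa-Todorov subcategory `D`, then `A` is a `1`-LIT
algebra with the same LIT module `V`.
The ideal is encoded as a right ideal (`Submodule Aᵐᵒᵖ A`) stable under left
multiplication; `rad(A)` is the Jacobson radical `Ideal.jacobson ⊥`.
-/
theorem stmt_14 (R A : Type u) [CommRing R] [IsArtinianRing R] [Ring A] [Algebra R A]
    [Module.Finite R A]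
    (L : AddMonoid.End (K0 Aᵐᵒᵖ)) (hL : IsSyzEnd L)
    (D : Set (FGMod Aᵐᵒᵖ)) (hD : IsZeroIT L D)
    (I : Submodule Aᵐᵒᵖ A) (hI : ∀ a : A, ∀ x ∈ I, a * x ∈ I)
    (hradI : ∀ x ∈ Ideal.jacobson (⊥ : Ideal A), ∀ y ∈ I, x * y = 0)
    (V : FGMod Aᵐᵒᵖ)
    (h0 : IsLITClass 0 V D (annClass I)) :
    IsLITClass 1 V D Set.univ := by
  have : Module.Finite R Aᵐᵒᵖ := .equiv (MulOpposite.opLinearEquiv R)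
  have : IsArtinianRing Aᵐᵒᵖ := .of_finite R Aᵐᵒᵖ
  have : IsArtinianRing A := .of_finite R A
  rintro M -
  refine h0 (syz M) fun m a ha ↦ ?_
  obtain ⟨P, f, ⟨hP, -, hf⟩, ⟨e⟩⟩ := isSyzygyOf_syz M
  have : Module.Projective Aᵐᵒᵖ P.carrier := hP
  have h : MulOpposite.op a • (e m : P.carrier) = 0 :=
    smul_eq_zero_of_mem_jacobson
      (fun j hj ↦ MulOpposite.unop_injective (hradI _ (unop_mem_jacobson hj) a ha))
      (le_jacobson_of_superfluous hf (e m).2)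
  apply e.injective
  rw [map_smul, map_zero]
  exact Subtype.ext h
end LIT
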